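/- arXiv:2603.15073 — 2 statements merged into one kernel-verified Lean document; each statement's English description precedes it below -/
import Mathlib

section
/- The period-4 orbit of g is attracting (a sink): for the period-4 point p with |p − 4.613677692731402| < 1/10 and g⁴(p) = p, the multiplier of the orbit satisfies |g'(p) · g'(g(p)) · g'(g²(p)) · g'(g³(p))| < 1. -/
noncomputable def g (x : ℝ) : ℝ :=
  (5/2) * x - x ^ 2 / 10 - x ^ 3 / 50 - x ^ 4 / 2000

theorem hasDerivAt_g (x : ℝ) :
    HasDerivAt g (5 / 2 - x / 5 - 3 * x ^ 2 / 50 - x ^ 3 / 500) x := by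
  have h := ((((hasDerivAt_id x).const_mul (5 / 2)).sub ((hasDerivAt_pow 2 x).div_const 10)).sub
    ((hasDerivAt_pow 3 x).div_const 50)).sub ((hasDerivAt_pow 4 x).div_const 2000)
  refine h.congr_deriv ?_
  norm_num
  ring

theorem deriv_g (x : ℝ) : deriv g x = 5 / 2 - x / 5 - 3 * x ^ 2 / 50 - x ^ 3 / 500 :=
  (hasDerivAt_g x).deriv

theorem deriv_g_antitoneOn : AntitoneOn (deriv g) (Set.Ici 0) := by
  intro x hx y _ hxy
  have hx : 0 ≤ x := hx
  have h₂ : x ^ 2 ≤ y ^ 2 := by gcongr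
  have h₃ : x ^ 3 ≤ y ^ 3 := by gcongr
  rw [deriv_g, deriv_g]
  linarith

theorem continuous_g : Continuous g :=
  continuous_iff_continuousAt.2 fun x => (hasDerivAt_g x).continuousAt

theorem g_monotoneOn : MonotoneOn g (Set.Icc 0 (472 / 100)) := by
  refine monotoneOn_of_deriv_nonneg (convex_Icc _ _) continuous_g.continuousOn
    (fun x _ => (hasDerivAt_g x).differentiableAt.differentiableWithinAt) fun x hx => ?_
  rw [interior_Icc] at hx
  refine le_trans ?_ (deriv_g_antitoneOn hx.1.le (Set.mem_Ici.2 (by norm_num)) hx.2.le)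
  rw [deriv_g]
  norm_num

theorem g_antitoneOn : AntitoneOn g (Set.Ici 5) := by
  refine antitoneOn_of_deriv_nonpos (convex_Ici _) continuous_g.continuousOn
    (fun x _ => (hasDerivAt_g x).differentiableAt.differentiableWithinAt) fun x hx => ?_
  rw [interior_Ici] at hx
  have hx : 5 < x := hx
  refine (deriv_g_antitoneOn (Set.mem_Ici.2 (by norm_num)) (Set.mem_Ici.2 (by linarith))
    hx.le).trans ?_
  rw [deriv_g]
  norm_num

/-- On `[l, u]` with `0 ≤ l`, the derivative of `g` is bounded by its values at the endpoints. -/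
theorem abs_deriv_g_le {l u x M : ℝ} (hl : 0 ≤ l) (hx : x ∈ Set.Icc l u)
    (hu : -M ≤ 5 / 2 - u / 5 - 3 * u ^ 2 / 50 - u ^ 3 / 500)
    (hlM : 5 / 2 - l / 5 - 3 * l ^ 2 / 50 - l ^ 3 / 500 ≤ M) : |deriv g x| ≤ M := by
  have hx₀ : 0 ≤ x := hl.trans hx.1
  rw [← deriv_g] at hu hlM
  exact abs_le.2 ⟨hu.trans (deriv_g_antitoneOn hx₀ (hx₀.trans hx.2) hx.2),
    (deriv_g_antitoneOn hl hx₀ hx.1).trans hlM⟩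

theorem period_four_orbit_is_sink (p : ℝ)
    (hp : |p - 4.613677692731402| < 1/10) (hper : g^[4] p = p)
    (h1 : |g p - 7.214907799688287| < 1/10)
    (h2 : |g^[2] p - 3.9654987245283035| < 1/10)
    (h3 : |g^[3] p - 6.9704245174643379| < 1/10) :
    |deriv g p * deriv g (g p) * deriv g (g^[2] p) * deriv g (g^[3] p)| < 1 := by
  rw [abs_lt] at hp h1 h2 h3
  have hpI : p ∈ Set.Icc (4.5135 : ℝ) 4.714 := by
    constructor <;> norm_num at hp ⊢ <;> linarith
  have hb : g p ≤ 7.222 := by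
    refine (g_monotoneOn ⟨by linarith [hpI.1], by linarith [hpI.2]⟩
      (by constructor <;> norm_num) hpI.2).trans ?_
    norm_num [g]
  have hbI : g p ∈ Set.Icc (7 : ℝ) 7.222 := ⟨by norm_num at h1; linarith, hb⟩
  have hc : 3.94 ≤ g^[2] p := by
    refine le_trans ?_ (g_antitoneOn (Set.mem_Ici.2 (by linarith [hbI.1]))
      (Set.mem_Ici.2 (by norm_num)) hb)
    norm_num [g]
  have hcI : g^[2] p ∈ Set.Icc (3.94 : ℝ) 4.1 := ⟨hc, by norm_num at h2 ⊢; linarith⟩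
  have heI : g^[3] p ∈ Set.Icc (6.8 : ℝ) 7.0705 := by
    constructor <;> norm_num at h3 ⊢ <;> linarith
  have hda : |deriv g p| ≤ 0.1915 :=
    abs_deriv_g_le (by norm_num) hpI (by norm_num) (by norm_num)
  have hdb : |deriv g (g p)| ≤ 2.83 :=
    abs_deriv_g_le (by norm_num) hbI (by norm_num) (by norm_num)
  have hdc : |deriv g (g^[2] p)| ≤ 0.67 :=
    abs_deriv_g_le (by norm_num) hcI (by norm_num) (by norm_num)
  have hde : |deriv g (g^[3] p)| ≤ 2.63 :=
    abs_deriv_g_le (by norm_num) heI (by norm_num) (by norm_num)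
  rw [abs_mul, abs_mul, abs_mul]
  calc |deriv g p| * |deriv g (g p)| * |deriv g (g^[2] p)| * |deriv g (g^[3] p)|
      ≤ 0.1915 * 2.83 * 0.67 * 2.63 := by gcongr
    _ < 1 := by norm_num
end

section
/- Almost every point of the invariant interval converges to the period-4 sink: for Lebesgue-almost every x ∈ [0, b], the distance from gⁿ(x) to the set {p, g(p), g²(p), g³(p)} tends to 0 as n → ∞. -/
/-- The derivative of `g`. -/
noncomputable def gSlope (x : ℝ) : ℝ :=
  5 / 2 - x / 5 - 3 * x ^ 2 / 50 - x ^ 3 / 500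

theorem gSlope_anti {x y : ℝ} (hx : 0 ≤ x) (hxy : x ≤ y) : gSlope y ≤ gSlope x := by
  have h2 : x ^ 2 ≤ y ^ 2 := by gcongr
  have h3 : x ^ 3 ≤ y ^ 3 := by gcongr
  unfold gSlope
  linarith

/-- `g` is concave on the nonnegative reals: its graph lies below its tangent lines. -/
theorem g_le_tangent {x y : ℝ} (hx : 0 ≤ x) (hy : 0 ≤ y) :
    g y ≤ g x + gSlope x * (y - x) := by
  have key : g x + gSlope x * (y - x) - g y =
      (y - x) ^ 2 * (1 / 10 + (y + 2 * x) / 50 + (y ^ 2 + 2 * x * y + 3 * x ^ 2) / 2000) := by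
    unfold g gSlope
    ring
  have : 0 ≤ g x + gSlope x * (y - x) - g y := by
    rw [key]
    positivity
  linarith

/-- A lower bound for the slope at the right end bounds all slopes from below. -/
theorem mul_sub_le_g_sub {m x y z : ℝ} (hx : 0 ≤ x) (hxy : x ≤ y) (hyz : y ≤ z)
    (hm : m ≤ gSlope z) : m * (y - x) ≤ g y - g x := by
  have h1 := g_le_tangent (hx.trans hxy) hx
  have h2 := gSlope_anti (hx.trans hxy) hyz
  nlinarith

/-- An upper bound for the slope at the left end bounds all slopes from above. -/
theorem g_sub_le_mul_sub {M w x y : ℝ} (hw : 0 ≤ w) (hwx : w ≤ x) (hxy : x ≤ y)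
    (hM : gSlope w ≤ M) : g y - g x ≤ M * (y - x) := by
  have h1 := g_le_tangent (hw.trans hwx) ((hw.trans hwx).trans hxy)
  have h2 := gSlope_anti hw hwx
  nlinarith

theorem strictMonoOn_g : StrictMonoOn g (Set.Icc 0 4.72) := by
  intro x hx y hy hxy
  have := mul_sub_le_g_sub (m := 0.001) hx.1 hxy.le hy.2 (by norm_num [gSlope])
  linarith

theorem strictAntiOn_g : StrictAntiOn g (Set.Ici 4.74) := by
  intro x hx y _ hxy
  have := g_sub_le_mul_sub (M := -0.001) (by norm_num) (Set.mem_Ici.1 hx) hxy.le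
    (by norm_num [gSlope])
  linarith

theorem g_mono {x y : ℝ} (hx : 0 ≤ x) (hxy : x ≤ y) (hy : y ≤ 4.72) : g x ≤ g y :=
  strictMonoOn_g.monotoneOn ⟨hx, hxy.trans hy⟩ ⟨hx.trans hxy, hy⟩ hxy

theorem g_anti {x y : ℝ} (hx : 4.74 ≤ x) (hxy : x ≤ y) : g y ≤ g x :=
  strictAntiOn_g.antitoneOn hx (hx.trans hxy) hxy

theorem g_le {x : ℝ} (hx : 0 ≤ x) : g x ≤ 7.222 := by
  have h := g_le_tangent (x := 4.73) (by norm_num) hx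
  norm_num [g, gSlope] at h ⊢
  linarith

theorem le_g_of_mem_Icc {x : ℝ} (hx : x ∈ Set.Icc (3.94 : ℝ) 5.4) : 6.95 ≤ g x := by
  obtain ⟨h1, h2⟩ := hx
  rcases le_total x 4.72 with h | h
  · have := g_mono (by norm_num) h1 h
    norm_num [g] at this ⊢
    linarith
  rcases le_total x 4.74 with h' | h'
  · have := mul_sub_le_g_sub (m := -1) (x := 4.72) (by norm_num) h h' (by norm_num [gSlope])
    norm_num [g] at this ⊢
    linarith
  · have := g_anti h' h2
    norm_num [g] at this ⊢
    linarith

/-! ### Orbits leaving intervals without fixed points -/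

theorem exists_lt_iterate {f : ℝ → ℝ} (hf : Continuous f) {x v : ℝ}
    (h : ∀ y ∈ Set.Icc x v, y < f y) : ∃ n, v < f^[n] x := by
  by_contra! hle
  have hge : ∀ n, x ≤ f^[n] x := by
    intro n
    induction n with
    | zero => rfl
    | succ n ih =>
      rw [Function.iterate_succ_apply']
      exact ih.trans (h _ ⟨ih, hle n⟩).le
  have hmono : Monotone fun n => f^[n] x := by
    refine monotone_nat_of_le_succ fun n => ?_
    rw [Function.iterate_succ_apply']
    exact (h _ ⟨hge n, hle n⟩).le
  have hlim := tendsto_atTop_ciSup hmono ⟨v, by rintro _ ⟨n, rfl⟩; exact hle n⟩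
  have hfix := isFixedPt_of_tendsto_iterate hlim hf.continuousAt
  have hmem := isClosed_Icc.mem_of_tendsto hlim (.of_forall fun n => ⟨hge n, hle n⟩)
  exact (h _ hmem).ne' hfix

theorem exists_iterate_lt {f : ℝ → ℝ} (hf : Continuous f) {x v : ℝ}
    (h : ∀ y ∈ Set.Icc v x, f y < y) : ∃ n, f^[n] x < v := by
  have hsemi : Function.Semiconj (fun y : ℝ => -y) f (fun y => -f (-y)) := fun y => by simp
  obtain ⟨n, hn⟩ := exists_lt_iterate (f := fun y => -f (-y)) (x := -x) (v := -v)
    (by fun_prop) fun y hy => by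
      have := h (-y) ⟨by linarith [hy.2], by linarith [hy.1]⟩
      linarith
  refine ⟨n, ?_⟩
  rw [← (hsemi.iterate_right n).eq x] at hn
  linarith

/-! ### Dynamics outside the immediate basin -/

/-- The orbit of `x` under `g` meets `s`. -/
def OrbitMeets (s : Set ℝ) (x : ℝ) : Prop := ∃ n, g^[n] x ∈ s

theorem OrbitMeets.of_mem {s : Set ℝ} {x : ℝ} (h : x ∈ s) : OrbitMeets s x := ⟨0, h⟩

theorem OrbitMeets.of_iterate {s : Set ℝ} {x : ℝ} (n : ℕ) (h : OrbitMeets s (g^[n] x)) :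
    OrbitMeets s x := by
  obtain ⟨m, hm⟩ := h
  exact ⟨m + n, by rwa [Function.iterate_add_apply]⟩

theorem OrbitMeets.trans {s t : Set ℝ} {x : ℝ} (h : OrbitMeets s x)
    (hst : ∀ y ∈ s, OrbitMeets t y) : OrbitMeets t x := by
  obtain ⟨n, hn⟩ := h
  exact (hst _ hn).of_iterate n

theorem exists_fixedPt_g :
    ∃ q ∈ Set.Ioo (6.18 : ℝ) 6.181, g q = q ∧ ∀ y ∈ Set.Ioo 0 q, y < g y := by
  have h5 : √5 ^ 2 = 5 := Real.sq_sqrt (by norm_num)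
  have hlo : 2.236 < √5 := Real.lt_sqrt_of_sq_lt (by norm_num)
  have hhi : √5 < 2.2362 := (Real.sqrt_lt' (by norm_num)).2 (by norm_num)
  have hfactor : ∀ y, g y - y = y * (y + 30) * (100 - 10 * y - y ^ 2) / 2000 := by
    intro y
    unfold g
    ring
  refine ⟨5 * (√5 - 1), ⟨by linarith, by linarith⟩, ?_, fun y hy => ?_⟩
  · have : 100 - 10 * (5 * (√5 - 1)) - (5 * (√5 - 1)) ^ 2 = 0 := by nlinarith
    have h := hfactor (5 * (√5 - 1))
    rw [this, mul_zero, zero_div] at h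
    linarith
  · have : 0 < 100 - 10 * y - y ^ 2 := by nlinarith [hy.1, hy.2]
    have h0 := hy.1
    have : 0 < g y - y := by
      rw [hfactor]
      positivity
    linarith

section Core

variable {q : ℝ}

theorem g_mem_of_fixedPt_lt (hq : q ∈ Set.Ioo (6.18 : ℝ) 6.181) (hfix : g q = q) {y : ℝ}
    (hy : y ∈ Set.Ioc q 7.222) : g y ∈ Set.Ico 3.94 q := by
  have h4 : (4.74 : ℝ) ≤ q := by linarith [hq.1]
  have h1 := strictAntiOn_g h4 (h4.trans hy.1.le) hy.1
  have h2 := g_anti (h4.trans hy.1.le) hy.2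
  refine ⟨le_trans (by norm_num [g]) h2, by rwa [hfix] at h1⟩

theorem g_mem_of_lt_fixedPt (hq : q ∈ Set.Ioo (6.18 : ℝ) 6.181) (hfix : g q = q) {y : ℝ}
    (hy : y ∈ Set.Ico 3.94 q) : g y ∈ Set.Ioc q 7.222 := by
  refine ⟨?_, g_le (by linarith [hy.1])⟩
  rcases le_total y 5.4 with h | h
  · linarith [le_g_of_mem_Icc ⟨hy.1, h⟩, hq.2]
  · have := strictAntiOn_g (Set.mem_Ici.2 (by linarith)) (Set.mem_Ici.2 (by linarith [hq.1])) hy.2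
    rwa [hfix] at this

theorem orbitMeets_core_of_pos (hq : q ∈ Set.Ioo (6.18 : ℝ) 6.181) (hfix : g q = q)
    (hlt : ∀ y ∈ Set.Ioo 0 q, y < g y) {x : ℝ} (hx : x ∈ Set.Ioc 0 7.222) :
    OrbitMeets (Set.Icc 3.94 q) x := by
  have hmaps : Set.MapsTo g (Set.Ioc 0 7.222) (Set.Ioc 0 7.222) := by
    intro y hy
    refine ⟨?_, g_le hy.1.le⟩
    rcases lt_or_ge y q with h | h
    · exact hy.1.trans (hlt y ⟨hy.1, h⟩)
    rcases h.eq_or_lt with rfl | h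
    · rw [hfix]; exact hy.1
    · linarith [(g_mem_of_fixedPt_lt hq hfix ⟨h, hy.2⟩).1]
  obtain ⟨n, hn⟩ := exists_lt_iterate continuous_g (x := x) (v := 3.94) fun y hy =>
    hlt y ⟨hx.1.trans_le hy.1, by linarith [hy.2, hq.1]⟩
  have hn' := (hmaps.iterate n hx).2
  refine OrbitMeets.of_iterate n ?_
  rcases le_or_gt (g^[n] x) q with h | h
  · exact .of_mem ⟨hn.le, h⟩
  · exact ⟨1, Set.Ico_subset_Icc_self (g_mem_of_fixedPt_lt hq hfix ⟨h, hn'⟩)⟩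

theorem orbitMeets_core (hq : q ∈ Set.Ioo (6.18 : ℝ) 6.181) (hfix : g q = q)
    (hlt : ∀ y ∈ Set.Ioo 0 q, y < g y) {b : ℝ} (hb : g b = 0) {x : ℝ} (hx : x ∈ Set.Icc 0 b) :
    OrbitMeets (insert 0 (Set.Icc 3.94 q)) x := by
  have hsub := Set.subset_insert (0 : ℝ) (Set.Icc 3.94 q)
  rcases hx.1.eq_or_lt with rfl | h0
  · exact .of_mem (Set.mem_insert _ _)
  rcases hx.2.eq_or_lt with rfl | hxb
  · exact ⟨1, Or.inl hb⟩
  rcases le_or_gt x 7.222 with h | h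
  · exact (orbitMeets_core_of_pos hq hfix hlt ⟨h0, h⟩).trans fun y hy => .of_mem (hsub hy)
  · have hpos : 0 < g x := by
      rw [← hb]
      exact strictAntiOn_g (Set.mem_Ici.2 (by linarith)) (Set.mem_Ici.2 (by linarith)) hxb
    refine OrbitMeets.of_iterate 1 ?_
    exact (orbitMeets_core_of_pos hq hfix hlt ⟨hpos, g_le hx.1⟩).trans fun y hy => .of_mem (hsub hy)

theorem g_g_lt_self (hq : q ∈ Set.Ioo (6.18 : ℝ) 6.181) (hfix : g q = q) {y : ℝ}
    (hy : y ∈ Set.Ico 5.4 q) : g (g y) < y := by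
  rcases le_total y 5.8 with h | h
  · have h1 := g_anti (by linarith [hy.1]) h
    have h2 : 6.64 ≤ g 5.8 := by norm_num [g]
    have h3 := g_anti (x := 6.64) (by norm_num) (by linarith : 6.64 ≤ g y)
    have h4 : g 6.64 < 5.4 := by norm_num [g]
    linarith [hy.1]
  · have hgy := (g_mem_of_lt_fixedPt hq hfix ⟨by linarith, hy.2⟩).1
    have h1 := g_sub_le_mul_sub (M := -1.06) (by norm_num) h hy.2.le (by norm_num [gSlope])
    have h2 := g_sub_le_mul_sub (M := -1.49) (by norm_num) hq.1.le hgy.le (by norm_num [gSlope])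
    rw [hfix] at h1 h2
    linarith [hy.2]

theorem orbitMeets_left (hq : q ∈ Set.Ioo (6.18 : ℝ) 6.181) (hfix : g q = q)
    {x : ℝ} (hx : x ∈ Set.Icc 3.94 q) : OrbitMeets (insert q (Set.Icc 3.94 4.7)) x := by
  rcases hx.2.eq_or_lt with rfl | hxq
  · exact .of_mem (Set.mem_insert _ _)
  have hmaps : Set.MapsTo g^[2] (Set.Ico 3.94 q) (Set.Ico 3.94 q) := fun y hy =>
    g_mem_of_fixedPt_lt hq hfix (g_mem_of_lt_fixedPt hq hfix hy)
  obtain ⟨n, hn⟩ := exists_iterate_lt (continuous_g.iterate 2) (x := x) (v := 5.4) fun y hy =>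
    g_g_lt_self hq hfix ⟨hy.1, hy.2.trans_lt hxq⟩
  have hmem := hmaps.iterate n ⟨hx.1, hxq⟩
  have h1 := le_g_of_mem_Icc ⟨hmem.1, hn.le⟩
  have h2 := g_anti (by norm_num) h1
  have h3 : g 6.95 ≤ 4.7 := by norm_num [g]
  rw [← Function.iterate_mul] at hmem h1 h2
  exact OrbitMeets.of_iterate (2 * n)
    ⟨2, Or.inr ⟨(g_mem_of_fixedPt_lt hq hfix (g_mem_of_lt_fixedPt hq hfix hmem)).1, h2.trans h3⟩⟩

end Core

theorem exists_fixedPt_g_g : ∃ r ∈ Set.Ioo (4.238 : ℝ) 4.24, g (g r) = r := by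
  have hc : ContinuousOn (fun x => x - g (g x)) (Set.Icc 4.238 4.24) :=
    (continuous_id.sub (continuous_g.comp continuous_g)).continuousOn
  obtain ⟨r, hr, h⟩ := intermediate_value_Ioo (by norm_num) hc
    (show (0 : ℝ) ∈ _ by constructor <;> norm_num [g])
  exact ⟨r, hr, by linarith⟩

section Pair

variable {r : ℝ}

theorem g_g_mem_left (hr : r ∈ Set.Ioo (4.238 : ℝ) 4.24) (hfix : g (g r) = r) {y : ℝ}
    (hy : y ∈ Set.Ioc r 4.72) : g (g y) ∈ Set.Ico 3.94 r := by
  have hr0 : g r ∈ Set.Ici (4.74 : ℝ) :=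
    Set.mem_Ici.2 (by linarith [le_g_of_mem_Icc (x := r) ⟨by linarith [hr.1], by linarith [hr.2]⟩])
  have h1 := strictMonoOn_g ⟨by linarith [hr.1], by linarith [hr.2]⟩
    ⟨by linarith [hr.1, hy.1], hy.2⟩ hy.1
  have h2 := strictAntiOn_g hr0 (hr0.trans h1.le) h1
  have h3 := g_anti (hr0.trans h1.le) (g_le (x := y) (by linarith [hr.1, hy.1]))
  exact ⟨le_trans (by norm_num [g]) h3, by rwa [hfix] at h2⟩

theorem g_g_mem_right (hr : r ∈ Set.Ioo (4.238 : ℝ) 4.24) (hfix : g (g r) = r) {y : ℝ}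
    (hy : y ∈ Set.Ico 3.94 r) : g (g y) ∈ Set.Ioc r 4.72 := by
  have hy0 := le_g_of_mem_Icc (x := y) ⟨hy.1, by linarith [hr.2, hy.2]⟩
  have h1 := strictMonoOn_g ⟨by linarith [hy.1], by linarith [hr.2, hy.2]⟩
    ⟨by linarith [hr.1], by linarith [hr.2]⟩ hy.2
  have h2 := strictAntiOn_g (Set.mem_Ici.2 (by linarith)) (Set.mem_Ici.2 (by linarith)) h1
  have h3 := g_anti (by norm_num) hy0
  exact ⟨by rwa [hfix] at h2, h3.trans (by norm_num [g])⟩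

/-- Near the repelling period-2 point, `g^[4]` pushes points to the right. -/
theorem lt_g_iterate_four_near (hr : r ∈ Set.Ioo (4.238 : ℝ) 4.24) (hfix : g (g r) = r)
    {y : ℝ} (hy : y ∈ Set.Ioc r 4.31) : y < g (g (g (g y))) := by
  have hy' := g_g_mem_left hr hfix ⟨hy.1, by linarith [hy.2]⟩
  obtain ⟨hr1, hr2⟩ := hr
  obtain ⟨hy1, hy2⟩ := hy
  have e1 : 7.115 ≤ g r := le_trans (by norm_num [g]) (g_mono (by norm_num) hr1.le (by linarith))
  have s1 := mul_sub_le_g_sub (m := 0.363) (by linarith) hy1.le hy2 (by norm_num [gSlope])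
  have s2 := g_sub_le_mul_sub (M := -2.68) (by norm_num) e1
    (g_mono (by linarith) hy1.le (by linarith)) (by norm_num [gSlope])
  have e2 : g y ≤ 7.146 := (g_mono (by linarith) hy2 (by norm_num)).trans (by norm_num [g])
  have e3 : 4.15 ≤ g (g y) := le_trans (by norm_num [g]) (g_anti (by linarith) e2)
  have e4 : 7.074 ≤ g (g (g y)) :=
    le_trans (by norm_num [g]) (g_mono (by norm_num) e3 (by linarith [hy'.2]))
  have s3 := mul_sub_le_g_sub (m := 0.42) (by linarith) hy'.2.le hr2.le (by norm_num [gSlope])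
  have s4 := g_sub_le_mul_sub (M := -2.625) (by norm_num) e4
    (g_mono (by linarith) hy'.2.le (by linarith)) (by norm_num [gSlope])
  rw [hfix] at s2 s4
  nlinarith

end Pair

/-- Lower bounds for `g^[4]` propagate to the right through enclosures of one orbit. -/
theorem lt_g_iterate_four_of_le {u y w₁ w₂ w₃ v : ℝ} (hu : 3.94 ≤ u) (huy : u ≤ y)
    (hy : y ≤ 4.72) (h₁ : w₁ ≤ g u) (h₂ : g w₁ ≤ w₂) (h₃ : g w₂ ≤ w₃) (h₄ : v < g w₃)
    (hw₁ : 4.74 ≤ w₁) (hw₂ : w₂ ≤ 4.72) : v < g (g (g (g y))) := by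
  have e1 : w₁ ≤ g y := h₁.trans (g_mono (by linarith) huy hy)
  have e2 : g (g y) ≤ w₂ := (g_anti hw₁ e1).trans h₂
  have e3 : 3.94 ≤ g (g y) :=
    le_trans (by norm_num [g]) (g_anti (hw₁.trans e1) (g_le (x := y) (by linarith)))
  have e4 : g (g (g y)) ≤ w₃ := (g_mono (by linarith) e2 hw₂).trans h₃
  have e5 := le_g_of_mem_Icc ⟨e3, by linarith⟩
  exact h₄.trans_le (g_anti (by linarith) e4)

theorem lt_g_iterate_four_far {y : ℝ} (hy : y ∈ Set.Icc (4.31 : ℝ) 4.51) :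
    y < g (g (g (g y))) := by
  obtain ⟨hlo, hhi⟩ := hy
  have key : ∀ u w₁ w₂ w₃ v : ℝ, (4 ≤ u ∧ w₁ ≤ g u ∧ g w₁ ≤ w₂ ∧ g w₂ ≤ w₃ ∧ v < g w₃ ∧
      4.74 ≤ w₁ ∧ w₂ ≤ 4.72) → u ≤ y → y ≤ v → y < g (g (g (g y))) :=
    fun u w₁ w₂ w₃ v ⟨hu, h₁, h₂, h₃, h₄, hw₁, hw₂⟩ huy hyv => hyv.trans_lt <|
      lt_g_iterate_four_of_le (by linarith) huy (by linarith) h₁ h₂ h₃ h₄ hw₁ hw₂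
  rcases le_total y 4.329 with h1 | h1
  · exact key 4.31 7.1435 4.1632 7.0815 4.329 (by norm_num [g]) hlo h1
  rcases le_total y 4.352 with h2 | h2
  · exact key 4.329 7.1503 4.1447 7.0724 4.352 (by norm_num [g]) h1 h2
  rcases le_total y 4.38 with h3 | h3
  · exact key 4.352 7.1581 4.1234 7.0616 4.38 (by norm_num [g]) h2 h3
  rcases le_total y 4.41 with h4 | h4
  · exact key 4.38 7.1669 4.0992 7.0489 4.41 (by norm_num [g]) h3 h4
  rcases le_total y 4.445 with h5 | h5
  · exact key 4.41 7.1757 4.075 7.0358 4.445 (by norm_num [g]) h4 h5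
  rcases le_total y 4.48 with h6 | h6
  · exact key 4.445 7.185 4.0492 7.0212 4.48 (by norm_num [g]) h5 h6
  · exact key 4.48 7.1932 4.0264 7.0079 4.51 (by norm_num [g]) h6 hhi

theorem orbitMeets_basin_of_lt {r : ℝ} (hr : r ∈ Set.Ioo (4.238 : ℝ) 4.24)
    (hfix : g (g r) = r) {x : ℝ} (hx : x ∈ Set.Ioc r 4.72) :
    OrbitMeets (Set.Icc 4.51 4.72) x := by
  have hmaps : Set.MapsTo g^[4] (Set.Ioc r 4.72) (Set.Ioc r 4.72) := fun y hy =>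
    g_g_mem_right hr hfix (g_g_mem_left hr hfix hy)
  obtain ⟨n, hn⟩ := exists_lt_iterate (continuous_g.iterate 4) (x := x) (v := 4.51) fun y hy => by
    rcases le_total y 4.31 with h | h
    · exact lt_g_iterate_four_near hr hfix ⟨hx.1.trans_le hy.1, h⟩
    · exact lt_g_iterate_four_far ⟨h, hy.2⟩
  have hmem := hmaps.iterate n hx
  rw [← Function.iterate_mul] at hn hmem
  exact ⟨4 * n, hn.le, hmem.2⟩

theorem orbitMeets_basin {r : ℝ} (hr : r ∈ Set.Ioo (4.238 : ℝ) 4.24)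
    (hfix : g (g r) = r) {x : ℝ} (hx : x ∈ Set.Icc (3.94 : ℝ) 4.7) :
    OrbitMeets (insert r (Set.Icc 4.51 4.72)) x := by
  have hsub := Set.subset_insert r (Set.Icc (4.51 : ℝ) 4.72)
  have hright : ∀ y ∈ Set.Ioc r 4.72, OrbitMeets (insert r (Set.Icc 4.51 4.72)) y := fun y hy =>
    (orbitMeets_basin_of_lt hr hfix hy).trans fun z hz => .of_mem (hsub hz)
  rcases lt_trichotomy x r with h | rfl | h
  · exact OrbitMeets.of_iterate 2 (hright _ (g_g_mem_right hr hfix ⟨hx.1, h⟩))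
  · exact .of_mem (Set.mem_insert _ _)
  · exact hright x ⟨h, by linarith [hx.2]⟩

/-! ### Contraction in the immediate basin -/

theorem g_iterate_four_sub_bounds {u v : ℝ} (hu : 4.51 ≤ u) (huv : u ≤ v) (hv : v ≤ 4.72) :
    0 ≤ g^[4] v - g^[4] u ∧ g^[4] v - g^[4] u ≤ 0.95 * (v - u) := by
  change 0 ≤ g (g (g (g v))) - g (g (g (g u))) ∧
    g (g (g (g v))) - g (g (g (g u))) ≤ 0.95 * (v - u)
  have a1 : 7.199 ≤ g u := le_trans (by norm_num [g]) (g_mono (by norm_num) hu (by linarith))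
  have b1 : g v ≤ 7.222 := g_le (by linarith)
  have m1 := g_mono (by linarith) huv hv
  have a2 : 3.94 ≤ g (g v) := le_trans (by norm_num [g]) (g_anti (by linarith) b1)
  have b2 : g (g u) ≤ 4.02 := (g_anti (by norm_num) a1).trans (by norm_num [g])
  have m2 := g_anti (by linarith) m1
  have a3 := le_g_of_mem_Icc ⟨a2, by linarith⟩
  have b3 : g (g (g u)) ≤ 7.005 :=
    (g_mono (by linarith) b2 (by norm_num)).trans (by norm_num [g])
  have m3 := g_mono (by linarith) m2 (by linarith)
  have m4 := g_anti (by linarith) m3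
  have s1 := g_sub_le_mul_sub (M := 0.195) (by norm_num) hu huv (by norm_num [gSlope])
  have s2 := mul_sub_le_g_sub (m := -2.83) (by linarith) m1 b1 (by norm_num [gSlope])
  have s3 := g_sub_le_mul_sub (M := 0.66) (by norm_num) a2 m2 (by norm_num [gSlope])
  have s4 := mul_sub_le_g_sub (m := -2.54) (by linarith) m3 b3 (by norm_num [gSlope])
  exact ⟨by linarith, by linarith⟩

theorem tendsto_iterate_four {p x : ℝ} (hp : p ∈ Set.Icc (4.51 : ℝ) 4.72) (hper : g^[4] p = p)
    (hx : x ∈ Set.Icc (4.51 : ℝ) 4.72) :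
    Filter.Tendsto (fun n => (g^[4])^[n] x) Filter.atTop (nhds p) := by
  have step : ∀ y ∈ Set.Icc (4.51 : ℝ) 4.72,
      g^[4] y ∈ Set.Icc (4.51 : ℝ) 4.72 ∧ |g^[4] y - p| ≤ 0.95 * |y - p| := by
    intro y hy
    rcases le_total y p with h | h
    · obtain ⟨h1, h2⟩ := g_iterate_four_sub_bounds hy.1 h hp.2
      rw [hper] at h1 h2
      rw [abs_of_nonpos (by linarith), abs_of_nonpos (by linarith)]
      exact ⟨⟨by linarith [hy.1], by linarith [hp.2]⟩, by linarith⟩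
    · obtain ⟨h1, h2⟩ := g_iterate_four_sub_bounds hp.1 h hy.2
      rw [hper] at h1 h2
      rw [abs_of_nonneg (by linarith), abs_of_nonneg (by linarith)]
      exact ⟨⟨by linarith [hp.1], by linarith [hy.2]⟩, by linarith⟩
  have hmaps : Set.MapsTo g^[4] (Set.Icc (4.51 : ℝ) 4.72) (Set.Icc (4.51 : ℝ) 4.72) :=
    fun y hy => (step y hy).1
  have bound : ∀ n, |(g^[4])^[n] x - p| ≤ 0.95 ^ n * |x - p| := by
    intro n
    induction n with
    | zero => simp
    | succ n ih =>
      rw [Function.iterate_succ_apply', pow_succ]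
      have := (step _ (hmaps.iterate n hx)).2
      linarith
  have hgeom : Filter.Tendsto (fun n : ℕ => (0.95 : ℝ) ^ n * |x - p|) Filter.atTop (nhds 0) := by
    simpa using (tendsto_pow_atTop_nhds_zero_of_lt_one (by norm_num : (0 : ℝ) ≤ 0.95)
      (by norm_num)).mul_const |x - p|
  exact tendsto_iff_dist_tendsto_zero.2 (squeeze_zero (fun _ => dist_nonneg) bound hgeom)

theorem tendsto_infDist_orbit {p x : ℝ}
    (hx : Filter.Tendsto (fun n => (g^[4])^[n] x) Filter.atTop (nhds p)) :
    Filter.Tendsto (fun n : ℕ => Metric.infDist (g^[n] x) {p, g p, g^[2] p, g^[3] p})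
      Filter.atTop (nhds 0) := by
  have hsum : Filter.Tendsto
      (fun k => ∑ j ∈ Finset.range 4, dist (g^[j] ((g^[4])^[k] x)) (g^[j] p))
      Filter.atTop (nhds 0) := by
    have := tendsto_finsetSum (Finset.range 4) fun j _ => tendsto_iff_dist_tendsto_zero.1
      (((continuous_g.iterate j).tendsto p).comp hx)
    simpa using this
  refine squeeze_zero (fun _ => Metric.infDist_nonneg) (fun n => ?_)
    (hsum.comp (Nat.tendsto_div_const_atTop (by norm_num : (4 : ℕ) ≠ 0)))
  have hlt : n % 4 < 4 := Nat.mod_lt _ (by norm_num)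
  have hmem : g^[n % 4] p ∈ ({p, g p, g^[2] p, g^[3] p} : Set ℝ) := by
    interval_cases n % 4 <;> simp
  have hn : g^[n] x = g^[n % 4] ((g^[4])^[n / 4] x) := by
    rw [← Function.iterate_mul, ← Function.iterate_add_apply, Nat.mod_add_div]
  calc Metric.infDist (g^[n] x) {p, g p, g^[2] p, g^[3] p}
      ≤ dist (g^[n % 4] ((g^[4])^[n / 4] x)) (g^[n % 4] p) := by
        rw [hn]
        exact Metric.infDist_le_dist_of_mem hmem
    _ ≤ _ := Finset.single_le_sum
        (f := fun j => dist (g^[j] ((g^[4])^[n / 4] x)) (g^[j] p))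
        (fun _ _ => dist_nonneg) (Finset.mem_range.2 hlt)

/-! ### The exceptional set -/

theorem finite_g_fiber (a : ℝ) : (g ⁻¹' {a}).Finite := by
  open Polynomial in
  let P : ℝ[X] :=
    C (5 / 2) * X - C (1 / 10) * X ^ 2 - C (1 / 50) * X ^ 3 - C (1 / 2000) * X ^ 4 - C a
  have heval : ∀ x, P.eval x = g x - a := by
    intro x
    simp only [P, g, Polynomial.eval_sub, Polynomial.eval_mul, Polynomial.eval_C,
      Polynomial.eval_X, Polynomial.eval_pow]
    ring
  have hP : P ≠ 0 := by
    intro h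
    have h0 := heval 0
    have h1 := heval 1
    norm_num [h, g] at h0 h1
    linarith
  refine (Polynomial.finite_setOfPred_isRoot hP).subset fun x hx => ?_
  have hx' : g x = a := hx
  simp [Polynomial.IsRoot, heval, hx']

theorem countable_setOf_orbitMeets {s : Set ℝ} (hs : s.Countable) :
    {x | OrbitMeets s x}.Countable := by
  have hpre : ∀ n : ℕ, (g^[n] ⁻¹' s).Countable := by
    intro n
    induction n with
    | zero => simpa using hs
    | succ n ih =>
      rw [Function.iterate_succ, Set.preimage_comp, ← Set.biUnion_preimage_singleton]
      exact ih.biUnion fun a _ => (finite_g_fiber a).countable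
  have : {x | OrbitMeets s x} = ⋃ n : ℕ, g^[n] ⁻¹' s := by
    ext x
    simp [OrbitMeets]
  rw [this]
  exact Set.countable_iUnion hpre

/-- Orbits that avoid the unstable periodic points enter the immediate basin of the sink. -/
theorem exists_countable_exceptional_set {b : ℝ} (hb : g b = 0) :
    ∃ s : Set ℝ, s.Countable ∧
      ∀ x ∈ Set.Icc 0 b, x ∉ s → OrbitMeets (Set.Icc 4.51 4.72) x := by
  obtain ⟨q, hq, hqfix, hlt⟩ := exists_fixedPt_g
  obtain ⟨r, hr, hrfix⟩ := exists_fixedPt_g_g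
  refine ⟨{x | OrbitMeets {0, q, r} x},
    countable_setOf_orbitMeets (Set.toFinite {0, q, r}).countable, fun x hx hxs => ?_⟩
  have hmeets : OrbitMeets ({0, q, r} ∪ Set.Icc 4.51 4.72) x := by
    refine (orbitMeets_core hq hqfix hlt hb hx).trans ?_
    rintro y (rfl | hy)
    · exact .of_mem (by simp)
    refine (orbitMeets_left hq hqfix hy).trans ?_
    rintro z (rfl | hz)
    · exact .of_mem (by simp)
    refine (orbitMeets_basin hr hrfix hz).trans ?_
    rintro w (rfl | hw)
    · exact .of_mem (by simp)
    · exact .of_mem (Or.inr hw)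
  obtain ⟨n, hn | hn⟩ := hmeets
  · exact absurd ⟨n, hn⟩ hxs
  · exact ⟨n, hn⟩

open MeasureTheory in
theorem almost_every_point_converges_to_sink
    (b : ℝ) (hb_pos : 0 < b) (hb_root : g b = 0)
    (hb_unique : ∀ y : ℝ, 0 < y → g y = 0 → y = b)
    (p : ℝ) (hp : |p - 4.613677692731402| < 1/10) (hper : g^[4] p = p)
    (h1 : |g p - 7.214907799688287| < 1/10)
    (h2 : |g^[2] p - 3.9654987245283035| < 1/10)
    (h3 : |g^[3] p - 6.9704245174643379| < 1/10) :
    ∀ᵐ x ∂(volume.restrict (Set.Icc (0 : ℝ) b)),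
      Filter.Tendsto
        (fun n : ℕ => Metric.infDist (g^[n] x) {p, g p, g^[2] p, g^[3] p})
        Filter.atTop (nhds 0) := by
  obtain ⟨s, hs, hbasin⟩ := exists_countable_exceptional_set hb_root
  have hp' : p ∈ Set.Icc (4.51 : ℝ) 4.72 := by
    rw [abs_lt] at hp
    exact ⟨by linarith [hp.1], by linarith [hp.2]⟩
  refine (ae_restrict_iff' measurableSet_Icc).2 ?_
  filter_upwards [hs.ae_notMem volume] with x hxs hx
  obtain ⟨N, hN⟩ := hbasin x hx hxs
  rw [← Filter.tendsto_add_atTop_iff_nat N]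
  simpa only [Function.iterate_add_apply] using
    tendsto_infDist_orbit (tendsto_iterate_four hp' hper hN)
end
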